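/- Let F = ℚ(q,a₁,a₂,b₁,b₂,Λ) be the field of rational functions over ℚ in the indeterminates q, a₁, a₂, b₁, b₂, Λ, let n ∈ ℕ, and set α := 1/(a₂b₂), β := 1/(a₁b₁), z := 1/(a₁b₂), w := Λ q^{n−1}. Let R = L_R D_R U_R and A = L_A D_A U_A be Ito's (n+1)×(n+1) Gauss-decomposed matrices over F (entries as in the commutativity theorem, with Λ in place of t^α), and let 𝖱ⁿ_{ij}(α,β|ζ) := β^{−i} (q;q)_n (α/ζ;q)_{n−j} (1/β;q)_{n−i} (β/ζ;q)_i / ((q;q)_i (q;q)_{n−i} (1/ζ;q)_n (1/β;q)_{n−j}) · Σ_{s=0}^{min(i,n−j)} (q^{−i};q)_s (q^{−n+j};q)_s (ζ/(αβ);q)_s (q^{−n+1}ζ;q)_s q^{s} / ((q;q)_s (q^{−n};q)_s (q^{−i+1}ζ/β;q)_s (q^{−n+j+1}ζ/α;q)_s). Then for all 0 ≤ i, j ≤ n: R_{ij} = 𝖱ⁿ_{ij}(α,β|z), and A_{ij} = (−a₁ w/α)^{n} · (1/w;q)_n / (w/(αβ);q)_n · 𝖱ⁿ_{ij}(α,β|w)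 · z^{j}. -/

import Mathlib

open Finset

/-- The `q`-shifted factorial `(a;q)_n = ∏_{i=0}^{n-1} (1 - a q^i)`. -/
noncomputable def qPoch {F : Type*} [Field F] (q a : F) (n : ℕ) : F :=
  ∏ i ∈ Finset.range n, (1 - a * q ^ i)

/-- The `q`-binomial coefficient `[m choose k]_q = (q;q)_m/((q;q)_k (q;q)_{m-k})`. -/
noncomputable def qBinom {F : Type*} [Field F] (q : F) (m k : ℕ) : F :=
  qPoch q q m / (qPoch q q k * qPoch q q (m - k))

/-- `C(m,2) = m(m-1)/2`. -/
def C2 (m : ℕ) : ℕ := m * (m - 1) / 2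

/-- The `₄φ₃`-type matrix entry `𝖱ⁿ_{ij}(α,β|ζ)` of Proposition D.5. -/
noncomputable def RHG {F : Type*} [Field F] (q α β ζ : F) (n i j : ℕ) : F :=
  β ^ (-(i : ℤ)) *
    (qPoch q q n * qPoch q (α / ζ) (n - j) * qPoch q (1 / β) (n - i) * qPoch q (β / ζ) i /
      (qPoch q q i * qPoch q q (n - i) * qPoch q (1 / ζ) n * qPoch q (1 / β) (n - j))) *
    ∑ s ∈ Finset.range (min i (n - j) + 1),
      qPoch q (q ^ (-(i : ℤ))) s * qPoch q (q ^ ((j : ℤ) - (n : ℤ))) s *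
          qPoch q (ζ / (α * β)) s * qPoch q (q ^ (1 - (n : ℤ)) * ζ) s * q ^ s /
        (qPoch q q s * qPoch q (q ^ (-(n : ℤ))) s *
          qPoch q (q ^ (1 - (i : ℤ)) * ζ / β) s *
          qPoch q (q ^ ((j : ℤ) - (n : ℤ) + 1) * ζ / α) s)

noncomputable section ItoMatrices

variable {F : Type*} [Field F]

/-- Lower-triangular factor `L_R` of Ito's matrix `R`. -/
def matLR (q a₁ a₂ b₁ b₂ : F) (n : ℕ) : Matrix (Fin (n + 1)) (Fin (n + 1)) F :=
  fun i j =>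
    if (j : ℕ) ≤ (i : ℕ) then
      qBinom q⁻¹ (n - (j : ℕ)) (n - (i : ℕ)) * (-1 : F) ^ ((i : ℕ) - (j : ℕ)) *
        q ^ (-(C2 ((i : ℕ) - (j : ℕ)) : ℤ)) *
        (qPoch q (a₂ * b₂ * q ^ (j : ℕ)) ((i : ℕ) - (j : ℕ)) /
          qPoch q (a₁⁻¹ * a₂ * q ^ (-((n : ℤ) - 2 * (j : ℕ) - 1))) ((i : ℕ) - (j : ℕ)))
    else 0

/-- Diagonal factor `D_R` of Ito's matrix `R`. -/
def matDR (q a₁ a₂ b₁ b₂ : F) (n : ℕ) : Matrix (Fin (n + 1)) (Fin (n + 1)) F :=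
  Matrix.diagonal fun j =>
    qPoch q (a₁ * a₂⁻¹ * q ^ (-(j : ℤ))) (n - (j : ℕ)) * qPoch q (a₂ * b₁) (j : ℕ) /
      (qPoch q (a₁ * b₂) (n - (j : ℕ)) *
        qPoch q (a₁⁻¹ * a₂ * q ^ (-((n : ℤ) - (j : ℕ)))) (j : ℕ))

/-- Upper-triangular factor `U_R` of Ito's matrix `R`. -/
def matUR (q a₁ a₂ b₁ b₂ : F) (n : ℕ) : Matrix (Fin (n + 1)) (Fin (n + 1)) F :=
  fun i j =>
    if (i : ℕ) ≤ (j : ℕ) then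
      qBinom q⁻¹ (j : ℕ) (i : ℕ) *
        (qPoch q (a₁ * b₁ * q ^ (n - (j : ℕ))) ((j : ℕ) - (i : ℕ)) /
          qPoch q (a₁ * a₂⁻¹ * q ^ ((n : ℤ) - (i : ℕ) - (j : ℕ))) ((j : ℕ) - (i : ℕ)))
    else 0

/-- Lower-triangular factor `L_A` of Ito's matrix `A`. -/
def matLA (q a₁ a₂ b₁ b₂ Λ : F) (n : ℕ) : Matrix (Fin (n + 1)) (Fin (n + 1)) F :=
  fun i j =>
    if (j : ℕ) ≤ (i : ℕ) then
      (-1 : F) ^ ((i : ℕ) - (j : ℕ)) *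
        q ^ ((C2 (n - (i : ℕ)) : ℤ) - (C2 (n - (j : ℕ)) : ℤ)) *
        qBinom q (n - (j : ℕ)) (n - (i : ℕ)) *
        (qPoch q (a₂ * b₂ * q ^ (j : ℕ)) ((i : ℕ) - (j : ℕ)) /
          qPoch q (Λ * a₂ * b₂ * q ^ (2 * (j : ℕ))) ((i : ℕ) - (j : ℕ)))
    else 0

/-- Diagonal factor `D_A` of Ito's matrix `A`. -/
def matDA (q a₁ a₂ b₁ b₂ Λ : F) (n : ℕ) : Matrix (Fin (n + 1)) (Fin (n + 1)) F :=
  Matrix.diagonal fun j =>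
    a₁ ^ (n - (j : ℕ)) * a₂ ^ (j : ℕ) * q ^ (C2 (j : ℕ) + C2 (n - (j : ℕ))) *
      (qPoch q Λ (j : ℕ) * qPoch q (Λ * a₂ * b₂ * q ^ (2 * (j : ℕ))) (n - (j : ℕ)) /
        (qPoch q (Λ * a₂ * b₂ * q ^ ((j : ℤ) - 1)) (j : ℕ) *
          qPoch q (Λ * a₁ * a₂ * b₁ * b₂ * q ^ ((n : ℤ) + (j : ℕ) - 1)) (n - (j : ℕ))))

/-- Upper-triangular factor `U_A` of Ito's matrix `A`. -/
def matUA (q a₁ a₂ b₁ b₂ Λ : F) (n : ℕ) : Matrix (Fin (n + 1)) (Fin (n + 1)) F :=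
  fun i j =>
    if (i : ℕ) ≤ (j : ℕ) then
      (-(Λ * a₁⁻¹ * a₂)) ^ ((j : ℕ) - (i : ℕ)) *
        q ^ ((C2 (j : ℕ) : ℤ) - (C2 (i : ℕ) : ℤ)) * qBinom q (j : ℕ) (i : ℕ) *
        (qPoch q (a₁ * b₁ * q ^ (n - (j : ℕ))) ((j : ℕ) - (i : ℕ)) /
          qPoch q (Λ * a₂ * b₂ * q ^ (2 * (i : ℕ))) ((j : ℕ) - (i : ℕ)))
    else 0

end ItoMatrices

/-- The field `F = ℚ(q,a₁,a₂,b₁,b₂,Λ)` of rational functions over `ℚ`. -/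
noncomputable abbrev F11 : Type := FractionRing (MvPolynomial (Fin 6) ℚ)

section qShiftedFactorial

variable {F : Type*} [Field F]

theorem qPoch_zero (q a : F) : qPoch q a 0 = 1 := by simp [qPoch]

theorem qPoch_succ (q a : F) (n : ℕ) : qPoch q a (n + 1) = qPoch q a n * (1 - a * q ^ n) := by
  simp [qPoch, prod_range_succ]

theorem qPoch_add (q a : F) (m n : ℕ) :
    qPoch q a (m + n) = qPoch q a m * qPoch q (a * q ^ m) n := by
  simp only [qPoch, prod_range_add, pow_add, mul_assoc]

theorem qPoch_ne_zero {q a : F} {n : ℕ} (h : ∀ k < n, a * q ^ k ≠ 1) : qPoch q a n ≠ 0 := by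
  rw [qPoch, prod_ne_zero_iff]
  intro k hk
  rw [sub_ne_zero]
  exact (h k (mem_range.mp hk)).symm

theorem qPoch_self_ne_zero {q : F} (hq : ∀ k : ℕ, q ^ (k + 1) ≠ 1) (n : ℕ) :
    qPoch q q n ≠ 0 :=
  qPoch_ne_zero fun k _ => by rw [← pow_succ']; exact hq k

theorem qPoch_mul_qPoch_shift (q a : F) {m n : ℕ} (h : m ≤ n) :
    qPoch q a m * qPoch q (a * q ^ m) (n - m) = qPoch q a n := by
  rw [← qPoch_add, Nat.add_sub_cancel' h]

theorem C2_succ (m : ℕ) : C2 (m + 1) = C2 m + m := by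
  simp only [C2]
  rw [Nat.triangle_succ]

theorem two_mul_C2 (m : ℕ) : 2 * (C2 m : ℤ) = m * (m - 1) := by
  induction m with
  | zero => simp [C2]
  | succ m ih => rw [C2_succ]; push_cast; linarith

/-- Reversal of a `q`-shifted factorial, with `y = q^{1-n}/x`. -/
theorem qPoch_reverse {q x y : F} {n : ℕ} (hq : q ≠ 0) (hxy : y * x * q ^ n = q) {k : ℕ}
    (h : k ≤ n) :
    qPoch q y k * qPoch q x (n - k) = (-y) ^ k * q ^ C2 k * qPoch q x n := by
  induction k with
  | zero => simp [qPoch_zero, C2]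
  | succ k ih =>
    obtain ⟨p, rfl⟩ := Nat.exists_eq_add_of_le h
    have ih := ih (by omega)
    rw [show k + 1 + p - k = p + 1 by omega, qPoch_succ] at ih
    rw [show k + 1 + p - (k + 1) = p by omega, qPoch_succ, C2_succ]
    have e : y * x * q ^ k * q ^ p = 1 := by
      apply mul_right_cancel₀ hq
      linear_combination hxy
    have e' : 1 - y * q ^ k = -y * q ^ k * (1 - x * q ^ p) := by linear_combination -e
    rw [e', pow_succ, pow_add]
    linear_combination (-y * q ^ k) * ih

theorem qPoch_zpow_neg_eq_zero {q : F} (hq : q ≠ 0) {p s : ℕ} (h : p < s) :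
    qPoch q (q ^ (-(p : ℤ))) s = 0 := by
  rw [qPoch, prod_eq_zero_iff]
  exact ⟨p, mem_range.mpr h, by simp [hq]⟩

theorem qPoch_zpow_neg_ne_zero {q : F} (hq0 : q ≠ 0) (hq : ∀ k : ℕ, q ^ (k + 1) ≠ 1) {n s : ℕ}
    (h : s ≤ n) : qPoch q (q ^ (-(n : ℤ))) s ≠ 0 := by
  refine qPoch_ne_zero fun k hk => ?_
  obtain ⟨p, rfl⟩ := Nat.exists_eq_add_of_lt (hk.trans_le h)
  intro hh
  apply hq p
  rw [zpow_neg, zpow_natCast, inv_mul_eq_one₀ (pow_ne_zero _ hq0), add_assoc, pow_add] at hh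
  exact mul_left_cancel₀ (pow_ne_zero k hq0) (hh.trans (mul_one _).symm)

/-- `x` is nonzero and not an integral power of `q`. -/
def QGeneric (q x : F) : Prop := x ≠ 0 ∧ ∀ k : ℤ, x * q ^ k ≠ 1

theorem QGeneric.qPoch_ne_zero {q x : F} (hq : q ≠ 0) (hx : QGeneric q x) (k : ℤ) (m : ℕ) :
    qPoch q (x * q ^ k) m ≠ 0 :=
  _root_.qPoch_ne_zero fun i _ => by
    rw [mul_assoc, ← zpow_natCast, ← zpow_add₀ hq]
    exact hx.2 _

theorem QGeneric.qPoch_ne_zero' {q x : F} (hx : QGeneric q x) (m : ℕ) :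
    qPoch q x m ≠ 0 :=
  _root_.qPoch_ne_zero fun i _ => by
    rw [← zpow_natCast]
    exact hx.2 _

theorem QGeneric.mul_zpow {q x : F} (hq : q ≠ 0) (hx : QGeneric q x) (k : ℤ) :
    QGeneric q (x * q ^ k) :=
  ⟨mul_ne_zero hx.1 (zpow_ne_zero _ hq), fun l => by
    rw [mul_assoc, ← zpow_add₀ hq]
    exact hx.2 _⟩

theorem QGeneric.inv {q x : F} (hx : QGeneric q x) : QGeneric q x⁻¹ :=
  ⟨inv_ne_zero hx.1, fun k hk => by
    apply hx.2 (-k)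
    rw [← inv_inj, mul_inv, zpow_neg, inv_inv, hk, inv_one]⟩

end qShiftedFactorial

section Bailey

variable {F : Type*} [Field F]

/-- The `q`-Pfaff–Saalschütz summation. -/
theorem qSaalschutz {q x y u c : F} (hq : ∀ k : ℕ, q ^ (k + 1) ≠ 1)
    (hc : ∀ k : ℕ, c * q ^ k ≠ 1) (hcu : c = x * y * u) (N : ℕ) :
    ∑ t ∈ range (N + 1), qPoch q x t * qPoch q y t * qPoch q u (N - t) * u ^ t /
        (qPoch q q t * qPoch q q (N - t) * qPoch q c t) =
      qPoch q (x * u) N * qPoch q (y * u) N / (qPoch q q N * qPoch q c N) := by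
  have hQ := qPoch_self_ne_zero hq
  have hC : ∀ n, qPoch q c n ≠ 0 := fun n => qPoch_ne_zero fun k _ => hc k
  have hq' : ∀ k : ℕ, 1 - q * q ^ k ≠ 0 := fun k => by
    rw [← pow_succ', sub_ne_zero]; exact (hq k).symm
  have hc' : ∀ k : ℕ, 1 - c * q ^ k ≠ 0 := fun k => sub_ne_zero.mpr (hc k).symm
  induction N with
  | zero => simp [qPoch_zero]
  | succ N ih =>
    have tele : ∀ M ≤ N, ∑ t ∈ range (M + 1),
        ((1 - q * q ^ N) * (1 - c * q ^ N) *
          (qPoch q x t * qPoch q y t * qPoch q u (N + 1 - t) * u ^ t /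
            (qPoch q q t * qPoch q q (N + 1 - t) * qPoch q c t)) -
          (1 - x * u * q ^ N) * (1 - y * u * q ^ N) *
          (qPoch q x t * qPoch q y t * qPoch q u (N - t) * u ^ t /
            (qPoch q q t * qPoch q q (N - t) * qPoch q c t))) =
        -(q ^ (N - M) * u * (qPoch q x (M + 1) * qPoch q y (M + 1) * qPoch q u (N - M) * u ^ M /
            (qPoch q q M * qPoch q q (N - M) * qPoch q c M))) := by
      intro M
      induction M with
      | zero =>
        intro _
        have h1 := hQ N
        have h2 := hq' N
        simp only [zero_add, sum_range_one, Nat.sub_zero, qPoch_zero, qPoch_succ, pow_zero]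
        field_simp
        rw [hcu]
        ring
      | succ M ihM =>
        intro hM
        obtain ⟨p, rfl⟩ := Nat.exists_eq_add_of_le hM
        rw [sum_range_succ, ihM (by omega)]
        have e1 : M + 1 + p + 1 - (M + 1) = p + 1 := by omega
        have e2 : M + 1 + p - (M + 1) = p := by omega
        have e3 : M + 1 + p - M = p + 1 := by omega
        rw [e1, e2, e3]
        have h1 := hQ M
        have h2 := hQ p
        have h3 := hC M
        have h4 := hq' M
        have h5 := hq' p
        have h6 := hc' M
        simp only [qPoch_succ, pow_add, pow_one]
        generalize q ^ M = T at *
        generalize q ^ p = P at *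
        generalize hA : 1 - q * T = A at *
        generalize hB : 1 - q * P = B at *
        generalize hD : 1 - c * T = D at *
        field_simp
        rw [← hA, ← hB, ← hD, hcu]
        ring
    have key := tele N le_rfl
    rw [sum_sub_distrib, ← mul_sum, ← mul_sum, ih] at key
    rw [sum_range_succ]
    have h1 := hQ N
    have h3 := hC N
    have h4 := hq' N
    have h6 := hc' N
    simp only [Nat.sub_self, qPoch_zero, qPoch_succ, pow_zero, pow_succ] at key ⊢
    rw [← mul_right_inj' (mul_ne_zero h4 h6), mul_add]
    have := sub_eq_iff_eq_add.mp key
    rw [this]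
    clear this key tele ih
    generalize hA : 1 - q * q ^ N = A at *
    generalize hD : 1 - c * q ^ N = D at *
    field_simp
    ring

/-- The `β`-sequence attached to an `α`-sequence in a Bailey pair relative to `a`. -/
noncomputable def baileyBeta (q a : F) (f : ℕ → F) (n : ℕ) : F :=
  ∑ r ∈ range (n + 1), f r / (qPoch q q (n - r) * qPoch q (a * q) (n + r))

/-- Bailey's lemma, with `aq = xyu`. -/
theorem bailey_lemma {q a x y u : F} (hq : ∀ k : ℕ, q ^ (k + 1) ≠ 1)
    (ha : ∀ k : ℕ, a * q * q ^ k ≠ 1) (haq : a * q = x * y * u) (f : ℕ → F) (m : ℕ) :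
    ∑ s ∈ range (m + 1), qPoch q x s * qPoch q y s * qPoch q u (m - s) * u ^ s /
        qPoch q q (m - s) * baileyBeta q a f s =
      ∑ r ∈ range (m + 1), qPoch q x r * qPoch q y r * u ^ r *
        qPoch q (x * u * q ^ r) (m - r) * qPoch q (y * u * q ^ r) (m - r) * f r /
        (qPoch q q (m - r) * qPoch q (a * q) (m + r)) := by
  have hQ := qPoch_self_ne_zero hq
  have hC : ∀ n, qPoch q (a * q) n ≠ 0 := fun n => qPoch_ne_zero fun k _ => ha k
  simp only [baileyBeta, mul_sum]
  rw [sum_comm' (t' := range (m + 1)) (s' := fun r => Ico r (m + 1))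
    (by intro s r; simp only [mem_range, mem_Ico]; omega)]
  refine sum_congr rfl fun r hr => ?_
  obtain ⟨N, rfl⟩ := Nat.exists_eq_add_of_le (Nat.lt_succ_iff.mp (mem_range.mp hr))
  have hc : ∀ k : ℕ, (x * q ^ r) * (y * q ^ r) * u * q ^ k ≠ 1 := fun k => by
    rw [show (x * q ^ r) * (y * q ^ r) * u * q ^ k = x * y * u * q ^ (r + r + k) by ring, ← haq]
    exact ha _
  have key := qSaalschutz hq hc rfl N
  have e0 : (x * q ^ r) * (y * q ^ r) * u = a * q * q ^ (r + r) := by rw [haq]; ring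
  rw [e0] at key
  rw [sum_Ico_eq_sum_range, show r + N + 1 - r = N + 1 by omega]
  have hD : ∀ n, qPoch q (a * q * q ^ (r + r)) n ≠ 0 := fun n => qPoch_ne_zero fun k _ => by
    rw [mul_assoc, ← pow_add]; exact ha _
  rw [show x * q ^ r * u = x * u * q ^ r by ring, show y * q ^ r * u = y * u * q ^ r by ring]
    at key
  rw [show r + N - r = N by omega, show r + N + r = (r + r) + N by omega, qPoch_add q (a * q)]
  have h1 := hC (r + r)
  have h2 := hD N
  have h3 := hQ N
  trans (qPoch q x r * qPoch q y r * u ^ r * f r / qPoch q (a * q) (r + r)) *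
    (qPoch q (x * u * q ^ r) N * qPoch q (y * u * q ^ r) N /
      (qPoch q q N * qPoch q (a * q * q ^ (r + r)) N))
  · rw [← key, mul_sum]
    refine sum_congr rfl fun t ht => ?_
    have ht := Nat.lt_succ_iff.mp (mem_range.mp ht)
    rw [show r + N - (r + t) = N - t by omega, show r + t - r = t by omega,
      show r + t + r = (r + r) + t by omega, qPoch_add q (a * q), qPoch_add q x, qPoch_add q y]
    have h4 := hD t
    have h5 := hQ t
    have h6 := hQ (N - t)
    rw [pow_add u]
    field_simp
  · field_simp

/-- The `α`-sequence of the unit Bailey pair. -/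
noncomputable def unitAlpha (q a : F) (r : ℕ) : F :=
  (-1) ^ r * q ^ C2 r * (1 - a * q ^ (2 * r)) * qPoch q a r / ((1 - a) * qPoch q q r)

theorem baileyBeta_unitAlpha {q a : F} (hq : ∀ k : ℕ, q ^ (k + 1) ≠ 1)
    (ha : ∀ k : ℕ, a * q ^ k ≠ 1) (n : ℕ) :
    baileyBeta q a (unitAlpha q a) n = if n = 0 then 1 else 0 := by
  have hQ := qPoch_self_ne_zero hq
  have ha0 : 1 - a ≠ 0 := by
    rw [sub_ne_zero]; simpa using (ha 0).symm
  have hC : ∀ n, qPoch q (a * q) n ≠ 0 := fun n => qPoch_ne_zero fun k _ => by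
    rw [mul_assoc, ← pow_succ']; exact ha _
  have hq' : ∀ k : ℕ, 1 - q * q ^ k ≠ 0 := fun k => by
    rw [← pow_succ', sub_ne_zero]; exact (hq k).symm
  have hc' : ∀ k : ℕ, 1 - a * q * q ^ k ≠ 0 := fun k => by
    rw [mul_assoc, ← pow_succ', sub_ne_zero]; exact (ha _).symm
  have hshift : ∀ r, qPoch q a (r + 1) = (1 - a) * qPoch q (a * q) r := fun r => by
    rw [add_comm, qPoch_add]; simp [qPoch]
  rcases n with _ | n
  · have : 1 - a ≠ 0 := ha0
    simp [baileyBeta, unitAlpha, qPoch_zero, C2, this]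
  · have tele : ∀ M ≤ n, ∑ r ∈ range (M + 1), unitAlpha q a r /
        (qPoch q q (n + 1 - r) * qPoch q (a * q) (n + 1 + r)) =
        (-1) ^ M * q ^ C2 (M + 1) * qPoch q (a * q) M /
          (qPoch q q M * qPoch q q (n - M) * qPoch q (a * q) (n + 1 + M) * (1 - q * q ^ n)) := by
      intro M
      induction M with
      | zero =>
        intro _
        have h1 := hQ n
        have h2 := hq' n
        have h3 := hC (n + 1)
        simp only [zero_add, sum_range_one, unitAlpha, Nat.sub_zero, add_zero, qPoch_succ q q,
          qPoch_zero, pow_zero, mul_zero, mul_one, C2, Nat.sub_self, Nat.zero_div, zero_mul]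
        field_simp
      | succ M ih =>
        intro hM
        obtain ⟨p, rfl⟩ := Nat.exists_eq_add_of_le hM
        rw [sum_range_succ, ih (by omega), unitAlpha]
        rw [show M + 1 + p + 1 - (M + 1) = p + 1 by omega, show M + 1 + p - (M + 1) = p by omega,
          show M + 1 + p - M = p + 1 by omega,
          show M + 1 + p + 1 + (M + 1) = (M + 1 + p + 1 + M) + 1 by omega, hshift,
          qPoch_succ q (a * q) (M + 1 + p + 1 + M), C2_succ (M + 1)]
        have h1 := hQ M
        have h2 := hQ p
        have h3 := hC (M + 1 + p + 1 + M)
        have h4 := hq' M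
        have h5 := hq' p
        have h6 := hc' (M + 1 + p + 1 + M)
        have h7 := hq' (M + 1 + p)
        simp only [qPoch_succ q q, qPoch_succ q (a * q) M]
        have e : 2 * (M + 1) = M + M + 1 + 1 := by ring
        simp only [e, pow_add, pow_one] at h6 h7 ⊢
        clear ih
        generalize q ^ M = T at *
        generalize q ^ p = P at *
        generalize hA : 1 - q * T = A at *
        generalize hB : 1 - q * P = B at *
        generalize hD : 1 - a * q * (T * q * P * q * T) = D at *
        generalize hE : 1 - q * (T * q * P) = E at *
        field_simp
        rw [← hA, ← hB, ← hD, ← hE]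
        ring
    rw [baileyBeta, sum_range_succ, tele n le_rfl, unitAlpha, hshift, Nat.sub_self, Nat.sub_self,
      ← add_assoc, qPoch_succ q (a * q) (n + 1 + n)]
    have h1 := hQ n
    have h3 := hC (n + 1 + n)
    have h4 := hq' n
    have h6 := hc' (n + 1 + n)
    simp only [qPoch_succ q q, qPoch_zero, if_neg (Nat.succ_ne_zero n)]
    rw [show a * q ^ (2 * (n + 1)) = a * q * q ^ (n + 1 + n) by ring]
    field_simp
    ring

end Bailey

section Watson

variable {F : Type*} [Field F]

theorem baileyBeta_sixPhiFive {q a x y u : F} (hq0 : q ≠ 0) (hq : ∀ k : ℕ, q ^ (k + 1) ≠ 1)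
    (ha : ∀ k : ℕ, a * q ^ k ≠ 1) (haq : a * q = x * y * u) {m : ℕ}
    (hx : qPoch q (x * u) m ≠ 0) (hy : qPoch q (y * u) m ≠ 0) :
    baileyBeta q a (fun r => qPoch q x r * qPoch q y r * u ^ r /
        (qPoch q (x * u) r * qPoch q (y * u) r) * unitAlpha q a r) m =
      qPoch q u m / (qPoch q q m * qPoch q (x * u) m * qPoch q (y * u) m) := by
  have key := bailey_lemma hq (fun k => by rw [mul_assoc, ← pow_succ']; exact ha _) haq
    (unitAlpha q a) m
  simp only [baileyBeta_unitAlpha hq ha] at key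
  rw [sum_eq_single 0 (by intro s _ hs; simp [hs]) (by simp)] at key
  simp only [qPoch_zero, if_true, pow_zero, Nat.sub_zero, mul_one, one_mul] at key
  rw [mul_assoc, ← div_div, key, baileyBeta, sum_div]
  refine sum_congr rfl fun r hr => ?_
  have hr := Nat.lt_succ_iff.mp (mem_range.mp hr)
  have h1 := qPoch_mul_qPoch_shift q (x * u) hr
  have h2 := qPoch_mul_qPoch_shift q (y * u) hr
  rw [← h1] at hx ⊢
  rw [← h2] at hy ⊢
  have h3 := left_ne_zero_of_mul hx
  have h4 := right_ne_zero_of_mul hx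
  have h5 := left_ne_zero_of_mul hy
  have h6 := right_ne_zero_of_mul hy
  have h7 := qPoch_self_ne_zero hq (m - r)
  have h8 : qPoch q (a * q) (m + r) ≠ 0 := qPoch_ne_zero fun k _ => by
    rw [mul_assoc, ← pow_succ']; exact ha _
  generalize qPoch q (x * u) r = R1 at *
  generalize qPoch q (y * u) r = R2 at *
  generalize qPoch q (x * u * q ^ r) (m - r) = R3 at *
  generalize qPoch q (y * u * q ^ r) (m - r) = R4 at *
  field_simp

/-- Watson's transformation of a terminating very-well-poised `₈φ₇` series into a balanced
`₄φ₃` series, with `aq = xyu = dev`. -/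
theorem watson {q a x y u d e v : F} (hq0 : q ≠ 0) (hq : ∀ k : ℕ, q ^ (k + 1) ≠ 1)
    (ha : ∀ k : ℕ, a * q ^ k ≠ 1) (haq : a * q = x * y * u) (haq' : a * q = d * e * v) {m : ℕ}
    (hx : ∀ s ≤ m, qPoch q (x * u) s ≠ 0) (hy : ∀ s ≤ m, qPoch q (y * u) s ≠ 0) :
    ∑ s ∈ range (m + 1), qPoch q d s * qPoch q e s * qPoch q v (m - s) * v ^ s /
        qPoch q q (m - s) *
        (qPoch q u s / (qPoch q q s * qPoch q (x * u) s * qPoch q (y * u) s)) =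
      ∑ r ∈ range (m + 1), qPoch q d r * qPoch q e r * v ^ r *
        qPoch q (d * v * q ^ r) (m - r) * qPoch q (e * v * q ^ r) (m - r) *
        (qPoch q x r * qPoch q y r * u ^ r /
          (qPoch q (x * u) r * qPoch q (y * u) r) * unitAlpha q a r) /
        (qPoch q q (m - r) * qPoch q (a * q) (m + r)) := by
  rw [← bailey_lemma hq (fun k => by rw [mul_assoc, ← pow_succ']; exact ha _) haq']
  refine sum_congr rfl fun s hs => ?_
  have hs := Nat.lt_succ_iff.mp (mem_range.mp hs)
  rw [baileyBeta_sixPhiFive hq0 hq ha haq (hx s hs) (hy s hs)]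

/-- Summand of the very-well-poised `₈φ₇` series shared by the entries of both of Ito's matrices. -/
noncomputable def vwpTerm (q a d e A B : F) (n i j k : ℕ) : F :=
  e⁻¹ ^ k * qPoch q d k * qPoch q e k * ((1 - a * q ^ (2 * k)) * qPoch q a k / (1 - a)) *
    qPoch q (a * q) (n + k) * qPoch q q (n - k) * qPoch q B (n - k) /
    (qPoch q q k * qPoch q q (i - k) * qPoch q q (j - k) * qPoch q (a * q) (i + k) *
      qPoch q (a * q) (j + k) * qPoch q A k)

theorem fourPhiThree_eq {q ζ A B a : F} {n i j : ℕ} (hq0 : q ≠ 0) (hq : ∀ k : ℕ, q ^ (k + 1) ≠ 1)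
    (hi : i ≤ n) (hj : j ≤ n) (hA : QGeneric q A) (hB : QGeneric q B) (hζ : QGeneric q ζ)
    (hζA : QGeneric q (ζ * A)) (hζB : QGeneric q (ζ * B)) (ha : a = ζ * A * q ^ (-(n : ℤ))) :
    qPoch q (B⁻¹ / ζ) i / qPoch q q i *
    ∑ s ∈ Finset.range (min i (n - j) + 1),
      qPoch q (q ^ (-(i : ℤ))) s * qPoch q (q ^ ((j : ℤ) - (n : ℤ))) s *
          qPoch q (ζ / (A⁻¹ * B⁻¹)) s * qPoch q (q ^ (1 - (n : ℤ)) * ζ) s * q ^ s /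
        (qPoch q q s * qPoch q (q ^ (-(n : ℤ))) s *
          qPoch q (q ^ (1 - (i : ℤ)) * ζ / B⁻¹) s *
          qPoch q (q ^ ((j : ℤ) - (n : ℤ) + 1) * ζ / A⁻¹) s) =
    qPoch q A i * qPoch q (q ^ (1 - (n : ℤ)) / B) i * qPoch q q j * qPoch q (a * q) j /
      (qPoch q q n * qPoch q B n * qPoch q (a * q) n) *
      ∑ k ∈ range (min i j + 1),
        vwpTerm q a (ζ * A * B) (q ^ (1 - (n : ℤ)) * ζ) A B n i j k := by
  have hQ := qPoch_self_ne_zero hq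
  have hag : QGeneric q a := ha ▸ hζA.mul_zpow hq0 _
  have haqg : QGeneric q (a * q) := by simpa using hag.mul_zpow hq0 1
  have hag' : ∀ k : ℕ, a * q ^ k ≠ 1 := fun k => by simpa using hag.2 k
  have hA0 := hA.1
  have hB0 := hB.1
  have hζ0 := hζ.1
  have hvg : QGeneric q (B⁻¹ / ζ) := by
    rw [div_eq_mul_inv, ← mul_inv, mul_comm]; exact hζB.inv
  have exu : a * q * q ^ n * q ^ ((j : ℤ) - n) = a * q * q ^ j := by
    rw [zpow_sub₀ hq0, zpow_natCast, zpow_natCast]; field_simp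
  have eyu : q ^ (-(j : ℤ)) * q ^ ((j : ℤ) - n) = q ^ (-(n : ℤ)) := by
    rw [← zpow_add₀ hq0]; congr 1; ring
  have h1 : a * q = (a * q * q ^ n) * q ^ (-(j : ℤ)) * q ^ ((j : ℤ) - n) := by
    rw [mul_assoc _ (q ^ (-(j : ℤ))), eyu, zpow_neg, zpow_natCast]; field_simp
  have eaq : a * q = ζ * A * q ^ (1 - (n : ℤ)) := by
    rw [ha, sub_eq_add_neg, zpow_add₀ hq0, zpow_one]; ring
  have h2 : a * q = (ζ * A * B) * (q ^ (1 - (n : ℤ)) * ζ) * (B⁻¹ / ζ) := by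
    rw [eaq]; field_simp
  have edv : ζ * A * B * (B⁻¹ / ζ) = A := by field_simp
  have eev : q ^ (1 - (n : ℤ)) * ζ * (B⁻¹ / ζ) = q ^ (1 - (n : ℤ)) / B := by field_simp
  have hxu : QGeneric q (a * q * q ^ j) := by simpa using haqg.mul_zpow hq0 j
  have W := watson (m := i) hq0 hq hag' h1 h2
    (fun s _ => by rw [exu]; exact hxu.qPoch_ne_zero' s)
    (fun s hs => by rw [eyu]; exact qPoch_zpow_neg_ne_zero hq0 hq (hs.trans hi))
  rw [exu, eyu, edv, eev] at W
  have L : ∑ s ∈ range (i + 1), qPoch q (ζ * A * B) s * qPoch q (q ^ (1 - (n : ℤ)) * ζ) s *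
      qPoch q (B⁻¹ / ζ) (i - s) * (B⁻¹ / ζ) ^ s / qPoch q q (i - s) *
        (qPoch q (q ^ ((j : ℤ) - n)) s /
          (qPoch q q s * qPoch q (a * q * q ^ j) s * qPoch q (q ^ (-(n : ℤ))) s)) =
      qPoch q (B⁻¹ / ζ) i / qPoch q q i *
    ∑ s ∈ Finset.range (min i (n - j) + 1),
      qPoch q (q ^ (-(i : ℤ))) s * qPoch q (q ^ ((j : ℤ) - (n : ℤ))) s *
          qPoch q (ζ / (A⁻¹ * B⁻¹)) s * qPoch q (q ^ (1 - (n : ℤ)) * ζ) s * q ^ s /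
        (qPoch q q s * qPoch q (q ^ (-(n : ℤ))) s *
          qPoch q (q ^ (1 - (i : ℤ)) * ζ / B⁻¹) s *
          qPoch q (q ^ ((j : ℤ) - (n : ℤ) + 1) * ζ / A⁻¹) s) := by
    rw [← sum_subset (s₁ := range (min i (n - j) + 1)), mul_sum]
    · refine sum_congr rfl fun s hs => ?_
      have hs := Nat.lt_succ_iff.mp (mem_range.mp hs)
      have hsi : s ≤ i := by omega
      have r1 := qPoch_reverse (x := q) (y := q ^ (-(i : ℤ))) (n := i) hq0
        (by rw [zpow_neg, zpow_natCast]; field_simp) hsi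
      have r2 := qPoch_reverse (x := B⁻¹ / ζ) (y := q ^ (1 - (i : ℤ)) * ζ / B⁻¹) (n := i) hq0
        (by rw [zpow_sub₀ hq0, zpow_natCast, zpow_one]; field_simp) hsi
      have e1 : ζ / (A⁻¹ * B⁻¹) = ζ * A * B := by field_simp
      have e2 : q ^ ((j : ℤ) - (n : ℤ) + 1) * ζ / A⁻¹ = a * q * q ^ j := by
        rw [eaq, ← zpow_natCast, mul_assoc, ← zpow_add₀ hq0]; field_simp; congr 1; ring
      rw [e1, e2]
      have n1 := hQ i
      have n2 := hQ (i - s)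
      have n3 := hQ s
      have n4 := hxu.qPoch_ne_zero' s
      have n5 : qPoch q (q ^ (-(n : ℤ))) s ≠ 0 :=
        qPoch_zpow_neg_ne_zero hq0 hq (hsi.trans hi)
      have n6 : qPoch q (q ^ (1 - (i : ℤ)) * ζ / B⁻¹) s ≠ 0 := by
        rw [show q ^ (1 - (i : ℤ)) * ζ / B⁻¹ = ζ * B * q ^ (1 - (i : ℤ)) by field_simp]
        exact hζB.qPoch_ne_zero hq0 _ _
      have n7 := hvg.qPoch_ne_zero' (i - s)
      have hqi : q ^ (1 - (i : ℤ)) = q * q ^ (-(i : ℤ)) := by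
        rw [sub_eq_add_neg, zpow_add₀ hq0, zpow_one]
      have rr : qPoch q (B⁻¹ / ζ) (i - s) * (B⁻¹ / ζ) ^ s * qPoch q q i *
          qPoch q (q ^ (1 - (i : ℤ)) * ζ / B⁻¹) s =
          qPoch q (B⁻¹ / ζ) i * qPoch q (q ^ (-(i : ℤ))) s * qPoch q q (i - s) * q ^ s := by
        have e3 : (-(q ^ (1 - (i : ℤ)) * ζ / B⁻¹)) ^ s * (B⁻¹ / ζ) ^ s =
            (-q ^ (-(i : ℤ))) ^ s * q ^ s := by
          rw [← mul_pow, ← mul_pow, hqi]; congr 1; field_simp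
        linear_combination (B⁻¹ / ζ) ^ s * qPoch q q i * r2 - qPoch q (B⁻¹ / ζ) i * q ^ s * r1 +
          q ^ C2 s * qPoch q (B⁻¹ / ζ) i * qPoch q q i * e3
      generalize qPoch q (q ^ (1 - (i : ℤ)) * ζ / B⁻¹) s = R1 at *
      generalize qPoch q (q ^ (-(i : ℤ))) s = R2 at *
      generalize qPoch q (B⁻¹ / ζ) i = R3 at *
      generalize qPoch q (B⁻¹ / ζ) (i - s) = R4 at *
      generalize (B⁻¹ / ζ) ^ s = R5 at *
      generalize qPoch q (a * q * q ^ j) s = R6 at *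
      generalize qPoch q (q ^ (-(n : ℤ))) s = R7 at *
      generalize qPoch q (q ^ ((j : ℤ) - n)) s = R8 at *
      generalize qPoch q (q ^ (1 - (n : ℤ)) * ζ) s = R9 at *
      generalize qPoch q (ζ * A * B) s = R10 at *
      field_simp
      linear_combination (R10 * R9 * R8) * rr
    · exact range_subset_range.mpr (by omega)
    · intro s hs hs'
      rw [mem_range] at hs hs'
      rw [show (j : ℤ) - n = -((n - j : ℕ) : ℤ) by push_cast [hj]; ring,
        qPoch_zpow_neg_eq_zero hq0 (by omega)]
      simp
  rw [← L, W, ← sum_subset (s₁ := range (min i j + 1)), mul_sum]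
  · refine sum_congr rfl fun k hk => ?_
    have hk := Nat.lt_succ_iff.mp (mem_range.mp hk)
    have hki : k ≤ i := by omega
    have hkj : k ≤ j := by omega
    have hqn : q ^ (1 - (n : ℤ)) = q * q ^ (-(n : ℤ)) := by
      rw [sub_eq_add_neg, zpow_add₀ hq0, zpow_one]
    have f1 := qPoch_mul_qPoch_shift q A hki
    have f2 := qPoch_mul_qPoch_shift q (q ^ (1 - (n : ℤ)) / B) hki
    have f3 := qPoch_reverse (x := B) (y := q ^ (1 - (n : ℤ)) / B) (n := n) hq0
      (by rw [zpow_sub₀ hq0, zpow_natCast, zpow_one]; field_simp) (hki.trans hi)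
    have f4 := qPoch_add q (a * q) n k
    have f5 := qPoch_reverse (x := q) (y := q ^ (-(j : ℤ))) (n := j) hq0
      (by rw [zpow_neg, zpow_natCast]; field_simp) hkj
    have f6 := qPoch_reverse (x := q) (y := q ^ (-(n : ℤ))) (n := n) hq0
      (by rw [zpow_neg, zpow_natCast]; field_simp) (hki.trans hi)
    have f7 := qPoch_add q (a * q) j k
    have f8 : (B⁻¹ / ζ) ^ k * (q ^ ((j : ℤ) - n)) ^ k * (-1) ^ k * (-q ^ (-(j : ℤ))) ^ k *
        (q ^ (1 - (n : ℤ)) * ζ) ^ k = (-q ^ (-(n : ℤ))) ^ k * (-(q ^ (1 - (n : ℤ)) / B)) ^ k := by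
      rw [← mul_pow, ← mul_pow, ← mul_pow, ← mul_pow, ← mul_pow, ← eyu]
      congr 1
      field_simp
    have n0 : 1 - a ≠ 0 := by rw [sub_ne_zero]; simpa using (hag' 0).symm
    have n1 := hA.qPoch_ne_zero' k
    have n2 := hB.qPoch_ne_zero' n
    have n3 : qPoch q (q ^ (1 - (n : ℤ)) / B) k ≠ 0 := by
      rw [div_eq_mul_inv, mul_comm]; exact hB.inv.qPoch_ne_zero hq0 _ _
    have n4 := haqg.qPoch_ne_zero' n
    have n5 := haqg.qPoch_ne_zero' j
    have n6 := haqg.qPoch_ne_zero' (i + k)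
    have n7 := hxu.qPoch_ne_zero' k
    have n8 : qPoch q (q ^ (-(n : ℤ))) k ≠ 0 := qPoch_zpow_neg_ne_zero hq0 hq (hki.trans hi)
    have n9 := hQ k
    have n10 := hQ (i - k)
    have n11 := hQ (j - k)
    have n12 := hQ n
    have n13 : (q ^ (1 - (n : ℤ)) * ζ) ^ k ≠ 0 := pow_ne_zero _ (mul_ne_zero (zpow_ne_zero _ hq0) hζ0)
    rw [vwpTerm, unitAlpha, f7, f4, ← f1, ← f2, inv_pow]
    clear f1 f2 f4 f7 W L
    generalize 1 - a = R0 at *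
    generalize qPoch q A k = R1 at *
    generalize qPoch q B n = R2 at *
    generalize qPoch q (q ^ (1 - (n : ℤ)) / B) k = R3 at *
    generalize qPoch q (a * q) n = R4 at *
    generalize qPoch q (a * q) j = R5 at *
    generalize qPoch q (a * q) (i + k) = R6 at *
    generalize qPoch q (a * q * q ^ j) k = R7 at *
    generalize qPoch q (q ^ (-(n : ℤ))) k = R8 at *
    generalize qPoch q q k = R9 at *
    generalize qPoch q q (i - k) = R10 at *
    generalize qPoch q q (j - k) = R11 at *
    generalize qPoch q q n = R12 at *
    generalize (q ^ (1 - (n : ℤ)) * ζ) ^ k = R13 at *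
    generalize qPoch q q j = R14 at *
    generalize qPoch q q (n - k) = R15 at *
    generalize qPoch q B (n - k) = R16 at *
    generalize qPoch q (q ^ (-(j : ℤ))) k = R17 at *
    generalize (B⁻¹ / ζ) ^ k = R18 at *
    generalize (q ^ ((j : ℤ) - n)) ^ k = R19 at *
    generalize (-q ^ (-(j : ℤ))) ^ k = R20 at *
    generalize (-q ^ (-(n : ℤ))) ^ k = R21 at *
    generalize (-(q ^ (1 - (n : ℤ)) / B)) ^ k = R22 at *
    generalize q ^ C2 k = R23 at *
    generalize 1 - a * q ^ (2 * k) = R24 at *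
    generalize qPoch q a k = R25 at *
    generalize qPoch q (q ^ (1 - (n : ℤ)) * ζ) k = R26 at *
    generalize qPoch q (ζ * A * B) k = R27 at *
    generalize qPoch q (A * q ^ k) (i - k) = R28 at *
    generalize qPoch q (q ^ (1 - (n : ℤ)) / B * q ^ k) (i - k) = R29 at *
    generalize qPoch q (a * q * q ^ n) k = R30 at *
    generalize (-1 : F) ^ k = R31 at *
    field_simp
    linear_combination (R27*R26*R28*R29*R30*R24*R25) * (R18*R19*R31*R23*R12*R2*R13*f5 + R23^2*R14*R12*R2*f8 - R14*R3*R16*f6 - R14*R21*R23*R12*f3)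
  · exact range_subset_range.mpr (by omega)
  · intro s hs hs'
    rw [mem_range] at hs hs'
    rw [qPoch_zpow_neg_eq_zero hq0 (p := j) (by omega)]
    simp

end Watson

section GaussTerms

variable {F : Type*} [Field F]

theorem RHG_eq {q ζ A B a : F} {n i j : ℕ} (hq0 : q ≠ 0) (hq : ∀ k : ℕ, q ^ (k + 1) ≠ 1)
    (hi : i ≤ n) (hj : j ≤ n) (hA : QGeneric q A) (hB : QGeneric q B) (hζ : QGeneric q ζ)
    (hζA : QGeneric q (ζ * A)) (hζB : QGeneric q (ζ * B)) (ha : a = ζ * A * q ^ (-(n : ℤ))) :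
    RHG q A⁻¹ B⁻¹ ζ n i j =
      (-q ^ (1 - (n : ℤ))) ^ i * q ^ C2 i * (-(ζ * A)⁻¹) ^ (n - j) * q ^ C2 (n - j) /
          qPoch q (1 / ζ) n *
        ∑ k ∈ range (min i j + 1), qPoch q A i * qPoch q q j /
          (qPoch q q (n - i) * qPoch q B (n - j)) *
          vwpTerm q a (ζ * A * B) (q ^ (1 - (n : ℤ)) * ζ) A B n i j k := by
  have h := fourPhiThree_eq hq0 hq hi hj hA hB hζ hζA hζB ha
  have hA0 := hA.1
  have hB0 := hB.1
  have hζ0 := hζ.1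
  have haq : QGeneric q (a * q) := by
    rw [ha]; simpa using (hζA.mul_zpow hq0 (-(n : ℤ))).mul_zpow hq0 1
  have r1 := qPoch_reverse (x := B) (y := q ^ (1 - (n : ℤ)) / B) (n := n) hq0
    (by rw [zpow_sub₀ hq0, zpow_natCast, zpow_one]; field_simp) hi
  have r2 := qPoch_reverse (x := a * q) (y := (ζ * A)⁻¹) (n := n) hq0
    (by rw [ha, zpow_neg, zpow_natCast]; field_simp) (Nat.sub_le n j)
  rw [Nat.sub_sub_self hj] at r2
  have e1 : B ^ i * (-(q ^ (1 - (n : ℤ)) / B)) ^ i = (-q ^ (1 - (n : ℤ))) ^ i := by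
    rw [← mul_pow]; congr 1; field_simp
  have e2 : A⁻¹ / ζ = (ζ * A)⁻¹ := by field_simp
  have n1 := qPoch_self_ne_zero hq i
  have n2 := qPoch_self_ne_zero hq n
  have n3 := qPoch_self_ne_zero hq (n - i)
  have n4 := hB.qPoch_ne_zero' n
  have n5 := hB.qPoch_ne_zero' (n - j)
  have n6 := haq.qPoch_ne_zero' n
  have n7 : qPoch q (1 / ζ) n ≠ 0 := by rw [one_div]; exact hζ.inv.qPoch_ne_zero' n
  rw [RHG, ← mul_sum]
  simp only [one_div B⁻¹, inv_inv, zpow_neg, zpow_natCast, inv_pow] at h ⊢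
  rw [e2]
  generalize ∑ k ∈ range (min i j + 1),
    vwpTerm q a (ζ * A * B) (q ^ (1 - (n : ℤ)) * ζ) A B n i j k = S at *
  generalize ∑ s ∈ range (min i (n - j) + 1), (_ : F) = T at *
  rw [← e1]
  clear e1 e2
  generalize -(q ^ (1 - (n : ℤ)) / B) = Y at *
  generalize qPoch q (q ^ (1 - (n : ℤ)) / B) i = R1 at *
  generalize qPoch q (B⁻¹ / ζ) i = R2 at *
  generalize qPoch q (ζ * A)⁻¹ (n - j) = R3 at *
  generalize (-(ζ * A)⁻¹) ^ (n - j) = R4 at *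
  generalize qPoch q (1 / ζ) n = R5 at *
  generalize qPoch q (a * q) n = R6 at *
  generalize qPoch q (a * q) j = R7 at *
  generalize qPoch q q i = R8 at *
  generalize qPoch q q (n - i) = R9 at *
  generalize qPoch q B (n - i) = R10 at *
  generalize qPoch q B (n - j) = R11 at *
  generalize qPoch q B n = R12 at *
  generalize qPoch q q n = R13 at *
  generalize qPoch q q j = R14 at *
  generalize qPoch q A i = R15 at *
  have h' : R2 * T = R8 * (R15 * R1 * R14 * R7 / (R13 * R12 * R6) * S) := by
    rw [← h]; field_simp
  rw [show B ^ i * (R13 * R3 * R10 * R2 / (R8 * R9 * R5 * R11)) * T =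
    B ^ i * (R13 * R3 * R10 / (R8 * R9 * R5 * R11)) * (R2 * T) by ring, h']
  field_simp
  linear_combination R15 * R14 * S * R3 * R7 * r1 +
    R15 * R14 * S * Y ^ i * q ^ C2 i * R12 * r2

theorem vwpTerm_eq {q a A : F} (d e B : F) {n i j k : ℕ} (hq : ∀ k : ℕ, q ^ (k + 1) ≠ 1)
    (hki : k ≤ i) (hkj : k ≤ j) (hi : i ≤ n) (hj : j ≤ n) (ha : ∀ m : ℕ, a * q ^ m ≠ 1)
    (hA : ∀ m : ℕ, A * q ^ m ≠ 1) (hB : ∀ m : ℕ, B * q ^ m ≠ 1) :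
    qBinom q (n - k) (n - i) * qBinom q j k *
        (qPoch q (A * q ^ k) (i - k) / qPoch q (a * q * q ^ (2 * k)) (i - k)) *
        (qPoch q (a * q * q ^ (2 * k)) (n - k) / qPoch q (a * q ^ k) k) *
        (qPoch q (B * q ^ (n - j)) (j - k) / qPoch q (a * q * q ^ (2 * k)) (j - k)) *
        (qPoch q d k * qPoch q e k * e⁻¹ ^ k) =
      qPoch q A i * qPoch q q j / (qPoch q q (n - i) * qPoch q B (n - j)) *
        vwpTerm q a d e A B n i j k := by
  have f1 := qPoch_mul_qPoch_shift q A hki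
  have f2 := qPoch_add q (a * q) (2 * k) (i - k)
  have f3 := qPoch_add q (a * q) (2 * k) (j - k)
  have f4 := qPoch_add q (a * q) (2 * k) (n - k)
  have f5 := qPoch_add q a k k
  have f6 := qPoch_add q B (n - j) (j - k)
  have f7 := qPoch_succ q a (2 * k)
  rw [add_comm, qPoch_add, qPoch_succ, qPoch_zero, pow_one, pow_zero, mul_one, one_mul] at f7
  rw [show 2 * k + (i - k) = i + k by omega] at f2
  rw [show 2 * k + (j - k) = j + k by omega] at f3
  rw [show 2 * k + (n - k) = n + k by omega] at f4
  rw [show n - j + (j - k) = n - k by omega] at f6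
  rw [← two_mul] at f5
  have hQ := qPoch_self_ne_zero hq
  have haq (m : ℕ) : qPoch q (a * q) m ≠ 0 := qPoch_ne_zero fun k _ => by
    rw [mul_assoc, ← pow_succ']; exact ha _
  have ha' (m : ℕ) : qPoch q a m ≠ 0 := qPoch_ne_zero fun k _ => ha _
  have hB' (m : ℕ) : qPoch q B m ≠ 0 := qPoch_ne_zero fun k _ => hB _
  have n1 := hQ (n - i)
  have n2 := hQ k
  have n3 := hQ (j - k)
  have n4 := hQ (i - k)
  have n5 := hB' (n - j)
  have n6 := haq (2 * k)
  have n7 := haq (i + k)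
  have n8 := haq (j + k)
  have n9 := ha' (2 * k)
  have n10 : 1 - a ≠ 0 := by rw [sub_ne_zero]; simpa using (ha 0).symm
  have n11 : qPoch q A k ≠ 0 := qPoch_ne_zero fun k _ => hA _
  rw [f2] at n7
  rw [f3] at n8
  rw [f5] at n9 f7
  rw [vwpTerm, qBinom, qBinom, f2, f3, f4, f6, ← f1, show n - k - (n - i) = i - k by omega]
  clear f1 f2 f3 f4 f5 f6
  generalize 1 - a = R0 at *
  generalize 1 - a * q ^ (2 * k) = R1 at *
  generalize qPoch q A k = R2 at *
  generalize qPoch q (a * q) (2 * k) = R3 at *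
  generalize qPoch q (a * q * q ^ (2 * k)) (i - k) = R4 at *
  generalize qPoch q (a * q * q ^ (2 * k)) (j - k) = R5 at *
  generalize qPoch q (a * q * q ^ (2 * k)) (n - k) = R6 at *
  generalize qPoch q (a * q ^ k) k = R7 at *
  generalize qPoch q a k = R8 at *
  generalize qPoch q B (n - j) = R9 at *
  generalize qPoch q (B * q ^ (n - j)) (j - k) = R10 at *
  generalize qPoch q (A * q ^ k) (i - k) = R11 at *
  generalize e⁻¹ ^ k = R12 at *
  generalize qPoch q d k = R13 at *
  generalize qPoch q e k = R14 at *
  generalize qPoch q q (n - i) = R15 at *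
  generalize qPoch q q (n - k) = R16 at *
  generalize qPoch q q (i - k) = R17 at *
  generalize qPoch q q (j - k) = R18 at *
  generalize qPoch q q k = R19 at *
  generalize qPoch q q j = R20 at *
  replace n7 := right_ne_zero_of_mul n7
  replace n8 := right_ne_zero_of_mul n8
  obtain ⟨n9, n12⟩ := mul_ne_zero_iff.mp n9
  field_simp
  linear_combination (R16 * R20 * R11 * R6 * R10 * R13 * R14 * R12) * f7

theorem mul_diagonal_mul_apply_eq_sum_range {n : ℕ} {L U : Matrix (Fin (n + 1)) (Fin (n + 1)) F}
    {D : Fin (n + 1) → F} {i j : Fin (n + 1)} (f : ℕ → F)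
    (hL : ∀ k, i < k → L i k = 0) (hU : ∀ k, j < k → U k j = 0)
    (hf : ∀ k, k ≤ i → k ≤ j → L i k * D k * U k j = f k) :
    (L * Matrix.diagonal D * U) i j = ∑ k ∈ range (min (i : ℕ) j + 1), f k := by
  rw [Matrix.mul_apply]
  have h : ∀ k : Fin (n + 1), (L * Matrix.diagonal D) i k * U k j =
      (fun m : ℕ => if m ∈ range (min (i : ℕ) j + 1) then f m else 0) k := fun k => by
    rw [Matrix.mul_diagonal]
    simp only [mem_range, Nat.lt_succ_iff, le_min_iff, Fin.val_fin_le]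
    split_ifs with hk
    · exact hf k hk.1 hk.2
    · rw [not_and_or, not_le, not_le] at hk
      rcases hk with hk | hk
      · rw [hL k hk]; simp
      · rw [hU k hk]; simp
  rw [sum_congr rfl fun k _ => h k, Fin.sum_univ_eq_sum_range
    (fun m => if m ∈ range (min (i : ℕ) j + 1) then f m else 0), sum_ite_mem, inter_eq_right.mpr (range_subset_range.mpr (by omega))]

end GaussTerms

section MatrixEntries

variable {F : Type*} [Field F]

theorem qPoch_inv_self {q : F} (hq0 : q ≠ 0) (m : ℕ) :
    qPoch q⁻¹ q⁻¹ m = (-1) ^ m * (q ^ C2 (m + 1))⁻¹ * qPoch q q m := by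
  induction m with
  | zero => simp [qPoch_zero, C2]
  | succ m ih =>
    rw [qPoch_succ, qPoch_succ, ih, C2_succ (m + 1), pow_add q, pow_succ q m,
      pow_succ (-1 : F), inv_pow]
    have h := pow_ne_zero m hq0
    generalize q ^ m = x at *
    field_simp
    ring

theorem qBinom_inv {q : F} (hq0 : q ≠ 0) {m k : ℕ} (h : k ≤ m) :
    qBinom q⁻¹ m k = (q ^ (k * (m - k)))⁻¹ * qBinom q m k := by
  obtain ⟨p, rfl⟩ := Nat.exists_eq_add_of_le h
  have e : C2 (k + p + 1) = C2 (k + 1) + C2 (p + 1) + k * p := by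
    have h1 := two_mul_C2 (k + p + 1)
    have h2 := two_mul_C2 (k + 1)
    have h3 := two_mul_C2 (p + 1)
    zify
    push_cast at h1 h2 h3
    linarith
  rw [qBinom, qBinom, qPoch_inv_self hq0, qPoch_inv_self hq0, qPoch_inv_self hq0,
    Nat.add_sub_cancel_left, e, pow_add, pow_add, pow_add]
  have h1 := pow_ne_zero (C2 (k + 1)) hq0
  have h2 := pow_ne_zero (C2 (p + 1)) hq0
  have h3 : (-1 : F) ^ k ≠ 0 := by simp
  have h4 : (-1 : F) ^ p ≠ 0 := by simp
  generalize (-1 : F) ^ k = x1 at *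
  generalize (-1 : F) ^ p = x2 at *
  generalize q ^ C2 (k + 1) = x3 at *
  generalize q ^ C2 (p + 1) = x4 at *
  field_simp

theorem matA_apply {q a₁ a₂ b₁ b₂ Λ w a : F} {n : ℕ} (hq0 : q ≠ 0)
    (hq : ∀ k : ℕ, q ^ (k + 1) ≠ 1) (ha₁ : a₁ ≠ 0) (hw : w = Λ * q ^ ((n : ℤ) - 1))
    (hΛ : Λ ≠ 0)
    (hA : QGeneric q (a₂ * b₂)) (hB : QGeneric q (a₁ * b₁)) (hwA : QGeneric q (w * (a₂ * b₂)))
    (hd : QGeneric q (w * (a₂ * b₂) * (a₁ * b₁)))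
    (ha : a = w * (a₂ * b₂) * q ^ (-(n : ℤ))) (i j : Fin (n + 1)) :
    (matLA q a₁ a₂ b₁ b₂ Λ n * matDA q a₁ a₂ b₁ b₂ Λ n * matUA q a₁ a₂ b₁ b₂ Λ n) i j =
      (-1) ^ (i : ℕ) * a₁ ^ n * (-(Λ * a₁⁻¹ * a₂)) ^ (j : ℕ) *
          q ^ (C2 (n - (i : ℕ)) + C2 (j : ℕ)) / qPoch q (w * (a₂ * b₂) * (a₁ * b₁)) n *
        ∑ k ∈ range (min (i : ℕ) j + 1), qPoch q (a₂ * b₂) i * qPoch q q j /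
          (qPoch q q (n - i) * qPoch q (a₁ * b₁) (n - j)) *
          vwpTerm q a (w * (a₂ * b₂) * (a₁ * b₁)) (q ^ (1 - (n : ℤ)) * w) (a₂ * b₂) (a₁ * b₁)
            n i j k := by
  rw [matDA, mul_sum]
  refine mul_diagonal_mul_apply_eq_sum_range (fun k => _ * (_ * vwpTerm q a _ _ _ _ n i j k))
    (fun k hk => if_neg (by simpa using hk)) (fun k hk => if_neg (by simpa using hk))
    fun k hki hkj => ?_
  have hag : QGeneric q a := ha ▸ hwA.mul_zpow hq0 _
  have haq : a * q = Λ * a₂ * b₂ := by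
    rw [ha, hw, zpow_neg, zpow_sub₀ hq0, zpow_natCast, zpow_one]; field_simp
  have eΛ : q ^ (1 - (n : ℤ)) * w = Λ := by
    rw [hw, zpow_sub₀ hq0, zpow_sub₀ hq0, zpow_natCast, zpow_one]; field_simp
  have hi := Nat.lt_succ_iff.mp i.2
  have hj := Nat.lt_succ_iff.mp j.2
  have hki' : (k : ℕ) ≤ i := hki
  have hkj' : (k : ℕ) ≤ j := hkj
  have key := vwpTerm_eq (w * (a₂ * b₂) * (a₁ * b₁)) Λ (a₁ * b₁) hq hki hkj hi hj
    (fun m => by simpa using hag.2 m) (fun m => by simpa using hA.2 m)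
    (fun m => by simpa using hB.2 m)
  rw [eΛ, ← key, matLA, matUA, if_pos (by simpa using hki), if_pos (by simpa using hkj), haq]
  have e1 : Λ * a₂ * b₂ * q ^ (((k : ℕ) : ℤ) - 1) = a * q ^ (k : ℕ) := by
    rw [← haq, zpow_sub₀ hq0, zpow_natCast, zpow_one]; field_simp
  have e2 : Λ * a₁ * a₂ * b₁ * b₂ * q ^ ((n : ℤ) + (k : ℕ) - 1) =
      w * (a₂ * b₂) * (a₁ * b₁) * q ^ (k : ℕ) := by
    rw [hw, add_sub_right_comm, zpow_add₀ hq0, zpow_natCast]; ring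
  rw [e1, e2, ← qPoch_mul_qPoch_shift q (w * (a₂ * b₂) * (a₁ * b₁)) (hki'.trans hi)]
  have s1 : a₁ ^ n = a₁ ^ (n - (k : ℕ)) * a₁ ^ (k : ℕ) := by rw [← pow_add]; congr 1; omega
  have s2 : (-(Λ * a₁⁻¹ * a₂)) ^ (j : ℕ) =
      (-(Λ * a₁⁻¹ * a₂)) ^ ((j : ℕ) - k) * ((-1) ^ (k : ℕ) * (Λ ^ (k : ℕ) * (a₁ ^ (k : ℕ))⁻¹ *
        a₂ ^ (k : ℕ))) := by
    rw [← inv_pow, ← mul_pow, ← mul_pow, ← mul_pow, neg_one_mul, ← pow_add]; congr 1; omega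
  have s3 : (-1 : F) ^ (i : ℕ) = (-1) ^ ((i : ℕ) - k) * (-1) ^ (k : ℕ) := by
    rw [← pow_add]; congr 1; omega
  have s4 : (-1 : F) ^ (k : ℕ) * (-1) ^ (k : ℕ) = 1 := by rw [← mul_pow]; simp
  have n1 := hd.qPoch_ne_zero' (k : ℕ)
  have n2 : qPoch q (w * (a₂ * b₂) * (a₁ * b₁) * q ^ (k : ℕ)) (n - (k : ℕ)) ≠ 0 := by
    simpa using hd.qPoch_ne_zero hq0 (k : ℕ) (n - (k : ℕ))
  have n3 := pow_ne_zero (k : ℕ) hΛ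
  have n4 := pow_ne_zero (k : ℕ) ha₁
  rw [s1, s2, s3, zpow_sub₀ hq0, zpow_sub₀ hq0, pow_add, pow_add, inv_pow]
  simp only [zpow_natCast]
  have n5 := pow_ne_zero (C2 (k : ℕ)) hq0
  have n6 := pow_ne_zero (C2 (n - (k : ℕ))) hq0
  generalize qPoch q (w * (a₂ * b₂) * (a₁ * b₁)) (k : ℕ) = R1 at n1 ⊢
  generalize qPoch q (w * (a₂ * b₂) * (a₁ * b₁) * q ^ (k : ℕ)) (n - (k : ℕ)) = R2 at n2 ⊢
  generalize Λ ^ (k : ℕ) = R3 at n3 ⊢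
  generalize a₁ ^ (k : ℕ) = R4 at n4 ⊢
  generalize q ^ C2 (k : ℕ) = R5 at n5 ⊢
  generalize q ^ C2 (n - (k : ℕ)) = R6 at n6 ⊢
  generalize (-1 : F) ^ (k : ℕ) = R7 at s4 ⊢
  generalize (-1 : F) ^ ((i : ℕ) - k) = R8
  generalize (-(Λ * a₁⁻¹ * a₂)) ^ ((j : ℕ) - k) = R9
  generalize qPoch q (a₂ * b₂ * q ^ (k : ℕ)) ((i : ℕ) - k) /
    qPoch q (Λ * a₂ * b₂ * q ^ (2 * (k : ℕ))) ((i : ℕ) - k) = R10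
  generalize qPoch q (a₁ * b₁ * q ^ (n - (j : ℕ))) ((j : ℕ) - k) /
    qPoch q (Λ * a₂ * b₂ * q ^ (2 * (k : ℕ))) ((j : ℕ) - k) = R11
  rw [mul_comm (qPoch q Λ k) (qPoch q (Λ * a₂ * b₂ * q ^ (2 * (k : ℕ))) (n - k)), mul_div_mul_comm]
  generalize qPoch q (Λ * a₂ * b₂ * q ^ (2 * (k : ℕ))) (n - k) / qPoch q (a * q ^ (k : ℕ)) k = R12
  generalize qPoch q Λ k = R13
  generalize qBinom q (n - k) (n - i) = R14
  generalize qBinom q j k = R15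
  generalize q ^ C2 (n - (i : ℕ)) = R16
  generalize q ^ C2 (j : ℕ) = R17
  generalize a₁ ^ (n - (k : ℕ)) = R18
  generalize a₂ ^ (k : ℕ) = R19
  have m : R5 * R5⁻¹ * (R6 * R6⁻¹) = R7 * R7 * (R4 * R4⁻¹) * (R3 * R3⁻¹) * (R1 * R1⁻¹) := by
    simp [*]
  linear_combination
    R8 * R14 * R10 * R15 * R11 * R9 * R16 * R17 * R18 * R19 * R12 * R13 * R2⁻¹ * m

theorem gaussR_power {q c : F} {n i j k : ℕ} (hq0 : q ≠ 0) (hc : c ≠ 0)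
    (hki : k ≤ i) (hkj : k ≤ j) (hi : i ≤ n) (hj : j ≤ n) :
    (q ^ ((n - i) * (i - k)))⁻¹ * (-1) ^ (i - k) * q ^ (-(C2 (i - k) : ℤ)) *
        ((-(c * q ^ (-(k : ℤ)))) ^ (n - k) * q ^ C2 (n - k)) * (q ^ (k * (j - k)))⁻¹ *
        ((-(c * q ^ ((n : ℤ) - k - j))) ^ (j - k) * q ^ C2 (j - k))⁻¹ =
      (-q ^ (1 - (n : ℤ))) ^ i * q ^ C2 i * (-c) ^ (n - j) * q ^ C2 (n - j) *
        ((-1) ^ k * q ^ C2 k) := by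
  have h1 : (-1 : F) ^ (i - k) = (-1) ^ i * (-1) ^ k := by
    rw [← pow_add, show i + k = i - k + 2 * k by omega, pow_add, pow_mul (-1 : F) 2]; simp
  have h2 : (-c) ^ (n - k) = (-c) ^ (n - j) * (-c) ^ (j - k) := by
    rw [← pow_add]; congr 1; omega
  have h3 : q ^ (-((n - i) * (i - k) : ℤ) + -C2 (i - k) + -k * (n - k) + C2 (n - k) +
      -(k * (j - k)) + -((n - k - j) * (j - k)) + -C2 (j - k)) =
      q ^ ((1 - (n : ℤ)) * i + C2 i + C2 (n - j) + C2 k) := by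
    congr 1
    have t1 := two_mul_C2 (i - k)
    have t2 := two_mul_C2 (n - k)
    have t3 := two_mul_C2 (j - k)
    have t4 := two_mul_C2 i
    have t5 := two_mul_C2 (n - j)
    have t6 := two_mul_C2 k
    push_cast [hki, hkj, hi, hj, hki.trans hi] at t1 t2 t3 t4 t5 t6
    apply mul_left_cancel₀ (two_ne_zero (α := ℤ))
    linear_combination -t1 + t2 - t3 - t4 - t5 - t6
  have h4 := pow_ne_zero (j - k) (neg_ne_zero.mpr hc)
  have h5 (x : ℤ) (m : ℕ) : (q ^ x) ^ m = q ^ (x * m) := by rw [zpow_mul, zpow_natCast]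
  rw [h1, ← neg_mul, ← neg_mul, mul_pow, mul_pow, h2, neg_pow (q ^ (1 - (n : ℤ)))]
  simp only [h5, ← zpow_natCast q, mul_inv, ← zpow_neg]
  push_cast [hki, hkj, hi, hj, hki.trans hi]
  simp only [zpow_add₀ hq0] at h3
  linear_combination (-1) ^ i * (-1) ^ k * (-c) ^ (n - j) * ((-c) ^ (j - k))⁻¹ *
    (-c) ^ (j - k) * h3 + (-1) ^ i * (-1) ^ k * (-c) ^ (n - j) * q ^ ((1 - (n : ℤ)) * i) *
      q ^ (C2 i : ℤ) * q ^ (C2 (n - j) : ℤ) * q ^ (C2 k : ℤ) * mul_inv_cancel₀ h4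

theorem matR_apply {q a₁ a₂ b₁ b₂ ζ a : F} {n : ℕ} (hq0 : q ≠ 0)
    (hq : ∀ k : ℕ, q ^ (k + 1) ≠ 1) (ha₁ : a₁ ≠ 0) (hζ' : ζ = 1 / (a₁ * b₂))
    (hA : QGeneric q (a₂ * b₂)) (hB : QGeneric q (a₁ * b₁)) (hζ : QGeneric q ζ)
    (hζA : QGeneric q (ζ * (a₂ * b₂))) 
    (ha : a = ζ * (a₂ * b₂) * q ^ (-(n : ℤ))) (i j : Fin (n + 1)) :
    (matLR q a₁ a₂ b₁ b₂ n * matDR q a₁ a₂ b₁ b₂ n * matUR q a₁ a₂ b₁ b₂ n) i j =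
      (-q ^ (1 - (n : ℤ))) ^ (i : ℕ) * q ^ C2 i * (-(ζ * (a₂ * b₂))⁻¹) ^ (n - (j : ℕ)) *
          q ^ C2 (n - j) / qPoch q (1 / ζ) n *
        ∑ k ∈ range (min (i : ℕ) j + 1), qPoch q (a₂ * b₂) i * qPoch q q j /
          (qPoch q q (n - i) * qPoch q (a₁ * b₁) (n - j)) *
          vwpTerm q a (ζ * (a₂ * b₂) * (a₁ * b₁)) (q ^ (1 - (n : ℤ)) * ζ) (a₂ * b₂) (a₁ * b₁)
            n i j k := by
  rw [matDR, mul_sum]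
  refine mul_diagonal_mul_apply_eq_sum_range (fun k => _ * (_ * vwpTerm q a _ _ _ _ n i j k))
    (fun k hk => if_neg (by simpa using hk)) (fun k hk => if_neg (by simpa using hk))
    fun k hki hkj => ?_
  have ha₂ : a₂ ≠ 0 := left_ne_zero_of_mul hA.1
  have hb₂ : b₂ ≠ 0 := right_ne_zero_of_mul hA.1
  have hb₁ : b₁ ≠ 0 := right_ne_zero_of_mul hB.1
  have hag : QGeneric q a := ha ▸ hζA.mul_zpow hq0 _
  have haqg : QGeneric q (a * q) := by simpa using hag.mul_zpow hq0 1
  have hi := Nat.lt_succ_iff.mp i.2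
  have hj := Nat.lt_succ_iff.mp j.2
  have hki' : (k : ℕ) ≤ i := hki
  have hkj' : (k : ℕ) ≤ j := hkj
  have hζa : ζ * (a₂ * b₂) = a * q ^ n := by
    rw [ha, zpow_neg, zpow_natCast]; field_simp
  have haa : a₁⁻¹ * a₂ = a * q ^ n := by rw [← hζa, hζ']; field_simp
  have haa' : a₁ * a₂⁻¹ = (a * q ^ n)⁻¹ := by rw [← haa, mul_inv, inv_inv]
  have key := vwpTerm_eq (ζ * (a₂ * b₂) * (a₁ * b₁)) (q ^ (1 - (n : ℤ)) * ζ) (a₁ * b₁) hq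
    hki hkj hi hj
    (fun m => by simpa using hag.2 m) (fun m => by simpa using hA.2 m)
    (fun m => by simpa using hB.2 m)
  have e1 : a₁⁻¹ * a₂ * q ^ (-((n : ℤ) - 2 * (k : ℕ) - 1)) = a * q * q ^ (2 * (k : ℕ)) := by
    rw [haa, show -((n : ℤ) - 2 * (k : ℕ) - 1) = -(n : ℤ) + 1 + (2 * (k : ℕ) : ℕ) by
      push_cast; ring, zpow_add₀ hq0, zpow_add₀ hq0, zpow_neg, zpow_natCast, zpow_natCast]
    field_simp
  have e2 : a₁⁻¹ * a₂ * q ^ (-((n : ℤ) - (k : ℕ))) = a * q ^ (k : ℕ) := by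
    rw [haa, neg_sub, zpow_sub₀ hq0, zpow_natCast, zpow_natCast]
    field_simp
  have e3 : ζ * (a₂ * b₂) * (a₁ * b₁) = a₂ * b₁ := by rw [hζ']; field_simp
  have e4 : 1 / ζ = a₁ * b₂ := by rw [hζ', one_div_one_div]
  have r1 := qPoch_reverse (x := a₁ * b₂) (y := q ^ (1 - (n : ℤ)) * ζ) (n := n) hq0
    (by rw [hζ', zpow_sub₀ hq0, zpow_natCast, zpow_one]; field_simp) (hki'.trans hi)
  have r2 := qPoch_reverse (x := a * q * q ^ (2 * (k : ℕ)))
    (y := a₁ * a₂⁻¹ * q ^ (-((k : ℕ) : ℤ))) (n := n - k) hq0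
    (by
      have h1 : q ^ n = q ^ (n - (k : ℕ)) * q ^ (k : ℕ) := by rw [← pow_add]; congr 1; omega
      rw [haa', zpow_neg, zpow_natCast, h1, mul_comm 2, pow_mul]
      have := hag.1
      field_simp) le_rfl
  have r3 := qPoch_reverse (x := a * q * q ^ (2 * (k : ℕ)))
    (y := a₁ * a₂⁻¹ * q ^ ((n : ℤ) - (k : ℕ) - (j : ℕ))) (n := j - k) hq0
    (by
      have h1 : q ^ (j : ℕ) = q ^ ((j : ℕ) - (k : ℕ)) * q ^ (k : ℕ) := by
        rw [← pow_add]; congr 1; omega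
      rw [haa', zpow_sub₀ hq0, zpow_sub₀ hq0, zpow_natCast, zpow_natCast, zpow_natCast, h1,
        mul_comm 2, pow_mul]
      have := hag.1
      field_simp) le_rfl
  rw [Nat.sub_self, qPoch_zero, mul_one] at r2 r3
  rw [← key, matLR, matUR, if_pos (by simpa using hki), if_pos (by simpa using hkj), e1, e2, e3,
    e4, qBinom_inv hq0 (show n - (i : ℕ) ≤ n - (k : ℕ) by omega), qBinom_inv hq0 hkj', r2, r3]
  rw [show n - (k : ℕ) - (n - i) = i - k by omega]
  have n1 : qPoch q (q ^ (1 - (n : ℤ)) * ζ) k ≠ 0 := by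
    rw [mul_comm]; exact hζ.qPoch_ne_zero hq0 _ _
  have n2 : qPoch q (a₁ * b₂) n ≠ 0 := by
    rw [← e4, one_div]; exact hζ.inv.qPoch_ne_zero' n
  have n3 : qPoch q (a₁ * b₂) (n - k) ≠ 0 := by
    rw [← e4, one_div]; exact hζ.inv.qPoch_ne_zero' _
  have n4 : (q ^ (1 - (n : ℤ)) * ζ) ^ (k : ℕ) ≠ 0 :=
    pow_ne_zero _ (mul_ne_zero (zpow_ne_zero _ hq0) hζ.1)
  have p := gaussR_power (c := (ζ * (a₂ * b₂))⁻¹) hq0 (inv_ne_zero hζA.1) hki' hkj' hi hj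
  rw [haa', ← hζa]
  have r1' : (qPoch q (a₁ * b₂) (n - k))⁻¹ * ((-1) ^ (k : ℕ) * q ^ C2 k) =
      qPoch q (q ^ (1 - (n : ℤ)) * ζ) k * (q ^ (1 - (n : ℤ)) * ζ)⁻¹ ^ (k : ℕ) *
        (qPoch q (a₁ * b₂) n)⁻¹ := by
    rw [neg_pow] at r1
    rw [inv_pow]
    field_simp
    linear_combination -r1
  clear key r1 r2 r3 e1 e2 e3 e4
  generalize (-q ^ (1 - (n : ℤ))) ^ (i : ℕ) * q ^ C2 i * (-(ζ * (a₂ * b₂))⁻¹) ^ (n - (j : ℕ)) *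
    q ^ C2 (n - j) = H at p ⊢
  generalize (-1 : F) ^ (k : ℕ) * q ^ C2 k = M at p r1'
  generalize (-((ζ * (a₂ * b₂))⁻¹ * q ^ (-((k : ℕ) : ℤ)))) ^ (n - (k : ℕ)) = Y₁ at p ⊢
  generalize (-((ζ * (a₂ * b₂))⁻¹ * q ^ ((n : ℤ) - (k : ℕ) - (j : ℕ)))) ^ ((j : ℕ) - k) = Y₂
    at p ⊢
  generalize qPoch q (a₂ * b₂ * q ^ (k : ℕ)) ((i : ℕ) - k) /
    qPoch q (a * q * q ^ (2 * (k : ℕ))) ((i : ℕ) - k) = X₁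
  generalize qPoch q (a₁ * b₁ * q ^ (n - (j : ℕ))) ((j : ℕ) - k) = X₂
  generalize qPoch q (a * q * q ^ (2 * (k : ℕ))) ((j : ℕ) - k) = X₃
  generalize qPoch q (a * q * q ^ (2 * (k : ℕ))) (n - k) = X₄
  generalize qPoch q (a * q ^ (k : ℕ)) k = X₅
  generalize qBinom q (n - k) (n - i) = X₆
  generalize qBinom q j k = X₇
  generalize qPoch q (a₂ * b₁) k = X₈
  generalize qPoch q (q ^ (1 - (n : ℤ)) * ζ) k = X₉ at r1' ⊢
  generalize (q ^ (1 - (n : ℤ)) * ζ)⁻¹ ^ (k : ℕ) = X₁₀ at r1' ⊢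
  generalize qPoch q (a₁ * b₂) (n - k) = X₁₁ at r1' ⊢
  generalize qPoch q (a₁ * b₂) n = X₁₂ at r1' ⊢
  generalize q ^ ((n - (i : ℕ)) * (i - k)) = Z₁ at p ⊢
  generalize q ^ ((k : ℕ) * (j - k)) = Z₂ at p ⊢
  generalize (-1 : F) ^ ((i : ℕ) - k) = Z₃ at p ⊢
  generalize q ^ (-(C2 ((i : ℕ) - k) : ℤ)) = Z₄ at p ⊢
  generalize q ^ C2 (n - (k : ℕ)) = Z₅ at p ⊢
  generalize q ^ C2 ((j : ℕ) - k) = Z₆ at p ⊢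
  linear_combination X₁ * X₂ * X₃⁻¹ * X₄ * X₅⁻¹ * X₆ * X₇ * X₈ * X₁₁⁻¹ * p +
    X₁ * X₂ * X₃⁻¹ * X₄ * X₅⁻¹ * X₆ * X₇ * X₈ * H * r1'

theorem gaussA_power {q a₁ a₂ b₂ Λ w z : F} {n i j : ℕ} (hq0 : q ≠ 0)
    (ha₁ : a₁ ≠ 0) (ha₂ : a₂ ≠ 0) (hb₂ : b₂ ≠ 0) (hΛ : Λ ≠ 0) (hi : i ≤ n) (hj : j ≤ n)
    (hw : w = Λ * q ^ ((n : ℤ) - 1)) (hz : z = 1 / (a₁ * b₂)) :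
    (-(a₁ * (w * (a₂ * b₂)))) ^ n * ((-q ^ (1 - (n : ℤ))) ^ i * q ^ C2 i *
        (-(w * (a₂ * b₂))⁻¹) ^ (n - j) * q ^ C2 (n - j)) * z ^ j =
      (-1) ^ i * a₁ ^ n * (-(Λ * a₁⁻¹ * a₂)) ^ j * q ^ (C2 (n - i) + C2 j) := by
  have hwA : w * (a₂ * b₂) ≠ 0 := by
    rw [hw]; exact mul_ne_zero (mul_ne_zero hΛ (zpow_ne_zero _ hq0)) (mul_ne_zero ha₂ hb₂)
  have h1 : w * (a₂ * b₂) * z = Λ * a₁⁻¹ * a₂ * q ^ ((n : ℤ) - 1) := by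
    rw [hw, hz]; field_simp
  have h2 : (-(w * (a₂ * b₂))) ^ n * (-(w * (a₂ * b₂))⁻¹) ^ (n - j) = (-(w * (a₂ * b₂))) ^ j := by
    rw [show (-(w * (a₂ * b₂))) ^ n = (-(w * (a₂ * b₂))) ^ j * (-(w * (a₂ * b₂))) ^ (n - j) by
      rw [← pow_add]; congr 1; omega, mul_assoc, ← mul_pow, neg_mul_neg, mul_inv_cancel₀ hwA,
      one_pow, mul_one]
  have h3 : (-(w * (a₂ * b₂))) ^ j * z ^ j =
      (-(Λ * a₁⁻¹ * a₂)) ^ j * (q ^ ((n : ℤ) - 1)) ^ j := by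
    rw [← mul_pow, ← mul_pow, neg_mul, h1, neg_mul]
  have h4 : (q ^ ((n : ℤ) - 1)) ^ j * (q ^ (1 - (n : ℤ))) ^ i * q ^ C2 i * q ^ C2 (n - j) =
      q ^ (C2 (n - i) + C2 j) := by
    simp only [← zpow_natCast, ← zpow_mul, ← zpow_add₀ hq0]
    congr 1
    have t1 := two_mul_C2 i
    have t2 := two_mul_C2 (n - j)
    have t3 := two_mul_C2 (n - i)
    have t4 := two_mul_C2 j
    push_cast [hi, hj] at t1 t2 t3 t4 ⊢
    apply mul_left_cancel₀ (two_ne_zero (α := ℤ))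
    linear_combination t1 + t2 - t3 - t4
  rw [← h4, ← mul_neg, mul_pow a₁, neg_pow (q ^ (1 - (n : ℤ)))]
  linear_combination a₁ ^ n * (-1) ^ i * (q ^ (1 - (n : ℤ))) ^ i * q ^ C2 i * q ^ C2 (n - j) *
    (z ^ j * h2 + h3)

end MatrixEntries

section Specialization

open MvPolynomial in
theorem qGeneric_of_eval {P Q : MvPolynomial (Fin 6) ℚ} {x : F11} (s : Fin 6 → ℚ) (hs : s 0 = 1)
    (hP : eval s P ≠ 0) (hPQ : eval s P ≠ eval s Q)
    (hx : x * algebraMap _ F11 Q = algebraMap _ F11 P) :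
    QGeneric (algebraMap (MvPolynomial (Fin 6) ℚ) F11 (X 0)) x := by
  have hinj := IsFractionRing.injective (MvPolynomial (Fin 6) ℚ) F11
  have hX : algebraMap (MvPolynomial (Fin 6) ℚ) F11 (X 0) ≠ 0 :=
    (map_ne_zero_iff _ hinj).mpr (X_ne_zero 0)
  refine ⟨?_, fun k hk => hPQ ?_⟩
  · rintro rfl
    rw [zero_mul] at hx
    exact hP (by rw [(map_eq_zero_iff _ hinj).mp hx.symm, map_zero])
  · obtain ⟨m, rfl | rfl⟩ := k.eq_nat_or_neg
    · have h : P * X 0 ^ m = Q := hinj (by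
        rw [map_mul, map_pow, ← hx]
        rw [zpow_natCast] at hk
        linear_combination algebraMap _ F11 Q * hk)
      simp [← h, hs]
    · have h : P = Q * X 0 ^ m := hinj (by
        rw [map_mul, map_pow, ← hx]
        rw [zpow_neg, zpow_natCast, mul_inv_eq_one₀ (pow_ne_zero _ hX)] at hk
        rw [hk, mul_comm])
      simp [h, hs]

end Specialization

/-- Proposition D.5: with `α = 1/(a₂b₂)`, `β = 1/(a₁b₁)`, `z = 1/(a₁b₂)`,
`w = Λq^{n-1}`, one has `R_{ij} = 𝖱ⁿ_{ij}(α,β|z)` and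
`A_{ij} = (-a₁w/α)^n (1/w;q)_n/(w/(αβ);q)_n · 𝖱ⁿ_{ij}(α,β|w) · z^j`. -/
theorem statement11
    (q a₁ a₂ b₁ b₂ Λ : F11)
    (hq : q = algebraMap (MvPolynomial (Fin 6) ℚ) F11 (MvPolynomial.X 0))
    (ha₁ : a₁ = algebraMap (MvPolynomial (Fin 6) ℚ) F11 (MvPolynomial.X 1))
    (ha₂ : a₂ = algebraMap (MvPolynomial (Fin 6) ℚ) F11 (MvPolynomial.X 2))
    (hb₁ : b₁ = algebraMap (MvPolynomial (Fin 6) ℚ) F11 (MvPolynomial.X 3))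
    (hb₂ : b₂ = algebraMap (MvPolynomial (Fin 6) ℚ) F11 (MvPolynomial.X 4))
    (hΛ : Λ = algebraMap (MvPolynomial (Fin 6) ℚ) F11 (MvPolynomial.X 5))
    (n : ℕ) (α β z w : F11)
    (hα : α = 1 / (a₂ * b₂)) (hβ : β = 1 / (a₁ * b₁)) (hz : z = 1 / (a₁ * b₂))
    (hw : w = Λ * q ^ ((n : ℤ) - 1)) :
    ∀ i j : Fin (n + 1),
      (matLR q a₁ a₂ b₁ b₂ n * matDR q a₁ a₂ b₁ b₂ n * matUR q a₁ a₂ b₁ b₂ n) i j =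
        RHG q α β z n (i : ℕ) (j : ℕ) ∧
      (matLA q a₁ a₂ b₁ b₂ Λ n * matDA q a₁ a₂ b₁ b₂ Λ n * matUA q a₁ a₂ b₁ b₂ Λ n) i j =
        (-(a₁ * w / α)) ^ n * (qPoch q (1 / w) n / qPoch q (w / (α * β)) n) *
          RHG q α β w n (i : ℕ) (j : ℕ) * z ^ (j : ℕ) := by
  intro i j
  have hi := Nat.lt_succ_iff.mp i.2
  have hj := Nat.lt_succ_iff.mp j.2
  have hinj := IsFractionRing.injective (MvPolynomial (Fin 6) ℚ) F11
  have hX (v : Fin 6) : algebraMap (MvPolynomial (Fin 6) ℚ) F11 (MvPolynomial.X v) ≠ 0 :=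
    (map_ne_zero_iff _ hinj).mpr (MvPolynomial.X_ne_zero v)
  have hq0 : q ≠ 0 := hq ▸ hX 0
  have ha₁0 : a₁ ≠ 0 := ha₁ ▸ hX 1
  have ha₂0 : a₂ ≠ 0 := ha₂ ▸ hX 2
  have hb₁0 : b₁ ≠ 0 := hb₁ ▸ hX 3
  have hb₂0 : b₂ ≠ 0 := hb₂ ▸ hX 4
  have hΛ0 : Λ ≠ 0 := hΛ ▸ hX 5
  have hq1 (k : ℕ) : q ^ (k + 1) ≠ 1 := fun h => by
    rw [hq, ← map_pow, ← map_one (algebraMap (MvPolynomial (Fin 6) ℚ) F11)] at h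
    simpa using congrArg (MvPolynomial.eval 0) (hinj h)
  have gen {P Q : MvPolynomial (Fin 6) ℚ} {x : F11}
      (hP : MvPolynomial.eval ![1, 2, 3, 5, 7, 11] P ≠ 0)
      (hPQ : MvPolynomial.eval ![1, 2, 3, 5, 7, 11] P ≠
        MvPolynomial.eval ![1, 2, 3, 5, 7, 11] Q)
      (hx : x * algebraMap _ F11 Q = algebraMap _ F11 P) : QGeneric q x :=
    hq ▸ qGeneric_of_eval _ rfl hP hPQ hx
  have gA : QGeneric q (a₂ * b₂) := gen (P := .X 2 * .X 4) (Q := 1)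
    (by simp) (by simp; norm_num) (by simp [ha₂, hb₂])
  have gB : QGeneric q (a₁ * b₁) := gen (P := .X 1 * .X 3) (Q := 1)
    (by simp) (by simp; norm_num) (by simp [ha₁, hb₁])
  have gz : QGeneric q z := gen (P := 1) (Q := .X 1 * .X 4)
    (by simp) (by simp; norm_num) (by
      rw [map_mul, map_one, ← ha₁, ← hb₂, hz]; field_simp)
  have gzA : QGeneric q (z * (a₂ * b₂)) := gen (P := .X 2) (Q := .X 1)
    (by simp) (by simp) (by rw [← ha₁, ← ha₂, hz]; field_simp)
  have gzB : QGeneric q (z * (a₁ * b₁)) := gen (P := .X 3) (Q := .X 4)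
    (by simp) (by simp) (by rw [← hb₁, ← hb₂, hz]; field_simp)
  have gw : QGeneric q w := by
    rw [hw]
    exact QGeneric.mul_zpow hq0 (gen (P := .X 5) (Q := 1) (by simp) (by simp) (by simp [hΛ])) _
  have gwA : QGeneric q (w * (a₂ * b₂)) := by
    rw [hw, mul_right_comm]
    exact QGeneric.mul_zpow hq0 (gen (P := .X 5 * (.X 2 * .X 4)) (Q := 1)
      (by simp) (by simp; norm_num) (by simp [hΛ, ha₂, hb₂])) _
  have gwB : QGeneric q (w * (a₁ * b₁)) := by
    rw [hw, mul_right_comm]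
    exact QGeneric.mul_zpow hq0 (gen (P := .X 5 * (.X 1 * .X 3)) (Q := 1)
      (by simp) (by simp; norm_num) (by simp [hΛ, ha₁, hb₁])) _
  have gwAB : QGeneric q (w * (a₂ * b₂) * (a₁ * b₁)) := by
    rw [hw, mul_right_comm Λ, mul_right_comm (Λ * (a₂ * b₂))]
    exact QGeneric.mul_zpow hq0 (gen (P := .X 5 * (.X 2 * .X 4) * (.X 1 * .X 3)) (Q := 1)
      (by simp) (by simp; norm_num) (by simp [hΛ, ha₁, hb₁, ha₂, hb₂])) _
  rw [hα, hβ, one_div (a₂ * b₂), one_div (a₁ * b₁)]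
  constructor
  · rw [matR_apply hq0 hq1 ha₁0 hz gA gB gz gzA rfl, RHG_eq hq0 hq1 hi hj gA gB gz gzA gzB rfl]
  · have e : w / ((a₂ * b₂)⁻¹ * (a₁ * b₁)⁻¹) = w * (a₂ * b₂) * (a₁ * b₁) := by field_simp
    have e' : a₁ * w / (a₂ * b₂)⁻¹ = a₁ * (w * (a₂ * b₂)) := by rw [div_inv_eq_mul, mul_assoc]
    have n1 : qPoch q (1 / w) n ≠ 0 := by rw [one_div]; exact gw.inv.qPoch_ne_zero' n
    rw [matA_apply hq0 hq1 ha₁0 hw hΛ0 gA gB gwA gwAB rfl,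
      RHG_eq hq0 hq1 hi hj gA gB gw gwA gwB rfl, e, e',
      ← gaussA_power hq0 ha₁0 ha₂0 hb₂0 hΛ0 hi hj hw hz]
    generalize ∑ k ∈ range (min (i : ℕ) j + 1), (_ : F11) = S
    generalize (-q ^ (1 - (n : ℤ))) ^ (i : ℕ) * q ^ C2 i * (-(w * (a₂ * b₂))⁻¹) ^ (n - (j : ℕ)) *
      q ^ C2 (n - j) = H
    generalize qPoch q (1 / w) n = D at n1 ⊢
    generalize qPoch q (w * (a₂ * b₂) * (a₁ * b₁)) n = D'
    generalize (-(a₁ * (w * (a₂ * b₂)))) ^ n = Y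
    linear_combination -Y * D'⁻¹ * H * S * z ^ (j : ℕ) * mul_inv_cancel₀ n1
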